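/- The truncation operation restores the total weight: for every utilization vector N, w(N^(2)) ≤ w(N). -/

import Mathlib

open Finset
open scoped Classical

noncomputable section

namespace IK

variable {ι : Type*} [Fintype ι]

/-- `Wcl wgt ℓ a b = Σ_{j=a}^{b} w_{ℓ,j}`, the total weight of items `a,…,b` of class `ℓ`. -/
def Wcl (wgt : ι → ℕ → ℝ) (ℓ : ι) (a b : ℕ) : ℝ := ∑ j ∈ Finset.Icc a b, wgt ℓ j

/-- The set `H(N)` of classes that are heavy for `N` (here `e = 1/ε`). -/
def heavy (e : ℕ) (N : ι → ℕ) : Finset ι := Finset.univ.filter fun ℓ => e < N ℓ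

/-- `W_H(N)`, the weight picked by `N` from heavy classes beyond their first `1/ε` items. -/
def WH (wgt : ι → ℕ → ℝ) (e : ℕ) (N : ι → ℕ) : ℝ :=
  ∑ ℓ ∈ heavy e N, Wcl wgt ℓ (e + 1) (N ℓ)

/-- `P2[x]`: the least integer power of `2` that is `≥ x` for `x > 0`, and `0` for `x ≤ 0`. -/
def P2 (x : ℝ) : ℝ := if 0 < x then (2 : ℝ) ^ ⌈Real.logb 2 x⌉ else 0

/-- The rounding unit `P2[(ε/|L|)·W_H(N)]`. -/
def base (ε : ℝ) (wgt : ι → ℕ → ℝ) (e : ℕ) (N : ι → ℕ) : ℝ :=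
  P2 (ε / (Fintype.card ι) * WH wgt e N)

/-- The multiplier `μ_ℓ(N)`: the unique integer with
`(μ_ℓ(N)−1)·P2[(ε/|L|)·W_H(N)] < W_ℓ(1/ε+1, N_ℓ) ≤ μ_ℓ(N)·P2[(ε/|L|)·W_H(N)]`. -/
def mu (ε : ℝ) (wgt : ι → ℕ → ℝ) (e : ℕ) (N : ι → ℕ) (ℓ : ι) : ℤ :=
  ⌈Wcl wgt ℓ (e + 1) (N ℓ) / base ε wgt e N⌉

/-- The over-estimate `E_ℓ(N) = μ_ℓ(N)·P2[(ε/|L|)·W_H(N)]`. -/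
def Ecl (ε : ℝ) (wgt : ι → ℕ → ℝ) (e : ℕ) (N : ι → ℕ) (ℓ : ι) : ℝ :=
  (mu ε wgt e N ℓ : ℝ) * base ε wgt e N

/-- The up-rounding `N^(1)` of `N`: coordinates of light classes are kept, while each heavy
class picks `max{k ∈ [1/ε+1, n_ℓ] : W_ℓ(1/ε+1, k) ≤ E_ℓ(N)}` items. -/
def upround (ε : ℝ) (wgt : ι → ℕ → ℝ) (nI : ι → ℕ) (e : ℕ) (N : ι → ℕ) : ι → ℕ :=
  fun ℓ =>
    if e < N ℓ then
      ((Finset.Icc (e + 1) (nI ℓ)).filter fun k => Wcl wgt ℓ (e + 1) k ≤ Ecl ε wgt e N ℓ).sup id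
    else N ℓ

/-- `Δ_ℓ(N) = N^(1)_ℓ − 1/ε`. -/
def delta (ε : ℝ) (wgt : ι → ℕ → ℝ) (nI : ι → ℕ) (e : ℕ) (N : ι → ℕ) (ℓ : ι) : ℕ :=
  upround ε wgt nI e N ℓ - e

/-- The truncation `N^(2)` of `N`: coordinates of light classes are kept, while each heavy
class eliminates its last `⌈2ε·Δ_ℓ(N)⌉` items from `N^(1)`. -/
def trunc (ε : ℝ) (wgt : ι → ℕ → ℝ) (nI : ι → ℕ) (e : ℕ) (N : ι → ℕ) : ι → ℕ :=
  fun ℓ =>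
    if e < N ℓ then
      upround ε wgt nI e N ℓ - (⌈2 * ε * (delta ε wgt nI e N ℓ : ℝ)⌉).toNat
    else upround ε wgt nI e N ℓ

/-- The total weight `w(N) = Σ_ℓ W_ℓ(1, N_ℓ)` of a utilization vector. -/
def wtot (wgt : ι → ℕ → ℝ) (N : ι → ℕ) : ℝ := ∑ ℓ : ι, Wcl wgt ℓ 1 (N ℓ)

end IK

namespace IK

variable {ι : Type*} [Fintype ι]

/-- The sum of the `m` smallest of `D` nondecreasing weights is at most an `m / D` fraction of
the total. -/
theorem sum_prefix_mul_le (f : ℕ → ℝ) (e m D : ℕ) (hmD : m ≤ D)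
    (hf : ∀ j k : ℕ, e + 1 ≤ j → j ≤ k → k ≤ e + D → f j ≤ f k) :
    (∑ j ∈ Finset.Icc (e + 1) (e + m), f j) * D ≤
      m * ∑ j ∈ Finset.Icc (e + 1) (e + D), f j := by
  induction D, hmD using Nat.le_induction with
  | base => rw [mul_comm]
  | succ D hD ih =>
    have h₁ := ih fun j k hj hjk hk => hf j k hj hjk (by omega)
    have h₂ : ∑ j ∈ Finset.Icc (e + 1) (e + m), f j ≤ m * f (e + D + 1) := by
      have h := Finset.sum_le_card_nsmul (Finset.Icc (e + 1) (e + m)) f (f (e + D + 1))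
        fun j hj => by
          rw [Finset.mem_Icc] at hj
          exact hf j _ hj.1 (by omega) (by omega)
      simpa using h
    rw [← add_assoc, Finset.sum_Icc_succ_top (by omega)]
    push_cast
    linarith

theorem P2_le_two_mul {x : ℝ} (hx : 0 < x) : P2 x ≤ 2 * x := by
  rw [P2, if_pos hx, ← Real.rpow_intCast]
  calc (2 : ℝ) ^ ((⌈Real.logb 2 x⌉ : ℤ) : ℝ) ≤ 2 ^ (Real.logb 2 x + 1) :=
        Real.rpow_le_rpow_of_exponent_le one_le_two (Int.ceil_lt_add_one _).le
    _ = 2 * x := by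
        rw [Real.rpow_add two_pos, Real.rpow_logb two_pos (by norm_num) hx, Real.rpow_one,
          mul_comm]

theorem P2_pos {x : ℝ} (hx : 0 < x) : 0 < P2 x := by
  rw [P2, if_pos hx]
  positivity

theorem Wcl_split {κ : Type*} (wgt : κ → ℕ → ℝ) (ℓ : κ) {e b : ℕ} (h : e ≤ b) :
    Wcl wgt ℓ 1 b = Wcl wgt ℓ 1 e + Wcl wgt ℓ (e + 1) b := by
  unfold Wcl
  induction b, h using Nat.le_induction with
  | base => simp
  | succ b hb ih =>
    rw [Finset.sum_Icc_succ_top (by omega), Finset.sum_Icc_succ_top (by omega), ih, add_assoc]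

section Rounding

variable {ε : ℝ} {e : ℕ} {nI : ι → ℕ} {wgt : ι → ℕ → ℝ} {N : ι → ℕ} {ℓ : ι}

theorem Wcl_le_Ecl (hb : 0 < base ε wgt e N) :
    Wcl wgt ℓ (e + 1) (N ℓ) ≤ Ecl ε wgt e N ℓ := by
  rw [Ecl, mu, ← div_le_iff₀ hb]
  exact Int.le_ceil _

theorem Ecl_le_add_base (hb : 0 < base ε wgt e N) :
    Ecl ε wgt e N ℓ ≤ Wcl wgt ℓ (e + 1) (N ℓ) + base ε wgt e N := by
  have h := (Int.ceil_lt_add_one (Wcl wgt ℓ (e + 1) (N ℓ) / base ε wgt e N)).le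
  have h' := mul_le_mul_of_nonneg_right h hb.le
  rwa [add_mul, one_mul, div_mul_cancel₀ _ hb.ne'] at h'

theorem upround_spec (hb : 0 < base ε wgt e N) (hℓ : e < N ℓ) (hN : N ℓ ≤ nI ℓ) :
    e < upround ε wgt nI e N ℓ ∧ upround ε wgt nI e N ℓ ≤ nI ℓ ∧
      Wcl wgt ℓ (e + 1) (upround ε wgt nI e N ℓ) ≤ Ecl ε wgt e N ℓ := by
  set s := (Finset.Icc (e + 1) (nI ℓ)).filter fun k => Wcl wgt ℓ (e + 1) k ≤ Ecl ε wgt e N ℓ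
    with hs
  have hmem : N ℓ ∈ s := by
    rw [hs, Finset.mem_filter, Finset.mem_Icc]
    exact ⟨⟨hℓ, hN⟩, Wcl_le_Ecl hb⟩
  have heq : upround ε wgt nI e N ℓ = s.sup id := by rw [upround, if_pos hℓ]
  obtain ⟨k, hk, hks⟩ := Finset.exists_mem_eq_sup s ⟨_, hmem⟩ id
  rw [heq, hks, id_eq]
  rw [hs, Finset.mem_filter, Finset.mem_Icc] at hk
  exact ⟨hk.1.1, hk.1.2, hk.2⟩

/-- Truncation keeps the first `1/ε` items of a heavy class and at most a `1 - 2ε` fraction of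
the estimate `E_ℓ(N)` beyond them. -/
theorem trunc_heavy (hε0 : 0 < ε) (hε : ε < 1 / 4)
    (hw0 : ∀ j ∈ Finset.Icc 1 (nI ℓ), 0 < wgt ℓ j)
    (hwm : ∀ j k : ℕ, 1 ≤ j → j ≤ k → k ≤ nI ℓ → wgt ℓ j ≤ wgt ℓ k)
    (hb : 0 < base ε wgt e N) (hℓ : e < N ℓ) (hN : N ℓ ≤ nI ℓ) :
    e ≤ trunc ε wgt nI e N ℓ ∧
      Wcl wgt ℓ (e + 1) (trunc ε wgt nI e N ℓ) ≤ (1 - 2 * ε) * Ecl ε wgt e N ℓ := by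
  obtain ⟨hlt, hle, hW⟩ := upround_spec (nI := nI) hb hℓ hN
  obtain ⟨D, hD⟩ := Nat.exists_eq_add_of_le hlt.le
  have hδ : delta ε wgt nI e N ℓ = D := by rw [delta, hD, Nat.add_sub_cancel_left]
  have hD0 : (0 : ℝ) < D := by
    have : 0 < D := by omega
    exact_mod_cast this
  set c := (⌈2 * ε * (D : ℝ)⌉).toNat with hc
  have hcD : c ≤ D := by
    rw [hc, Int.toNat_le, Int.ceil_le]
    push_cast
    nlinarith
  have hcε : 2 * ε * (D : ℝ) ≤ c := by
    have h₁ := Int.le_ceil (2 * ε * (D : ℝ))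
    have h₂ : ((⌈2 * ε * (D : ℝ)⌉ : ℤ) : ℝ) ≤ (c : ℝ) := by
      exact_mod_cast Int.self_le_toNat _
    exact h₁.trans h₂
  have ht : trunc ε wgt nI e N ℓ = e + (D - c) := by
    rw [trunc, if_pos hℓ, hδ, hD, ← hc]
    omega
  rw [hD] at hW hle
  rw [ht]
  refine ⟨Nat.le_add_right _ _, ?_⟩
  have hS : 0 ≤ Wcl wgt ℓ (e + 1) (e + D) := Finset.sum_nonneg fun j hj => by
    rw [Finset.mem_Icc] at hj
    exact (hw0 j (Finset.mem_Icc.2 ⟨by omega, by omega⟩)).le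
  have hkey : Wcl wgt ℓ (e + 1) (e + (D - c)) * D ≤
      ((D - c : ℕ) : ℝ) * Wcl wgt ℓ (e + 1) (e + D) :=
    sum_prefix_mul_le (wgt ℓ) e (D - c) D (Nat.sub_le _ _)
      fun j k hj hjk hk => hwm j k (by omega) hjk (by omega)
  rw [Nat.cast_sub hcD] at hkey
  have hkept : Wcl wgt ℓ (e + 1) (e + (D - c)) ≤
      (1 - 2 * ε) * Wcl wgt ℓ (e + 1) (e + D) := by
    refine le_of_mul_le_mul_right (hkey.trans ?_) hD0
    calc ((D : ℝ) - c) * Wcl wgt ℓ (e + 1) (e + D)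
        ≤ ((1 - 2 * ε) * D) * Wcl wgt ℓ (e + 1) (e + D) :=
          mul_le_mul_of_nonneg_right (by linarith) hS
      _ = (1 - 2 * ε) * Wcl wgt ℓ (e + 1) (e + D) * D := by ring
  exact hkept.trans (mul_le_mul_of_nonneg_left hW (by linarith))

theorem trunc_light (hℓ : ¬ e < N ℓ) : trunc ε wgt nI e N ℓ = N ℓ := by
  rw [trunc, if_neg hℓ, upround, if_neg hℓ]

theorem WH_pos (hw0 : ∀ ℓ, ∀ j ∈ Finset.Icc 1 (nI ℓ), 0 < wgt ℓ j)
    (hN : ∀ ℓ, N ℓ ≤ nI ℓ) (h : (heavy e N).Nonempty) : 0 < WH wgt e N := by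
  refine Finset.sum_pos (fun ℓ hℓ => ?_) h
  rw [heavy, Finset.mem_filter] at hℓ
  refine Finset.sum_pos (fun j hj => hw0 ℓ j ?_) (Finset.nonempty_Icc.2 hℓ.2)
  rw [Finset.mem_Icc] at hj ⊢
  exact ⟨by omega, hj.2.trans (hN ℓ)⟩

theorem card_heavy_mul_base_le [Nonempty ι] (hε0 : 0 < ε) (hW : 0 < WH wgt e N) :
    ((heavy e N).card : ℝ) * base ε wgt e N ≤ 2 * ε * WH wgt e N := by
  have hn : (0 : ℝ) < Fintype.card ι := by exact_mod_cast Fintype.card_pos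
  have hx : 0 < ε / (Fintype.card ι) * WH wgt e N := by positivity
  have hcard : ((heavy e N).card : ℝ) ≤ Fintype.card ι := by
    exact_mod_cast Finset.card_le_univ _
  calc ((heavy e N).card : ℝ) * base ε wgt e N
      ≤ (Fintype.card ι) * (2 * (ε / (Fintype.card ι) * WH wgt e N)) :=
        mul_le_mul hcard (P2_le_two_mul hx) (P2_pos hx).le hn.le
    _ = 2 * ε * WH wgt e N := by field_simp

end Rounding

end IK

/-- The truncation operation restores the total weight: for every utilization
vector `N`, `w(N^(2)) ≤ w(N)`. -/
theorem stmt7 {ι : Type*} [Fintype ι] [Nonempty ι]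
    (ε : ℝ) (e : ℕ) (hε0 : 0 < ε) (hε : ε < 1 / 4) (he : (e : ℝ) * ε = 1)
    (nI : ι → ℕ) (wgt : ι → ℕ → ℝ)
    (hw0 : ∀ ℓ, ∀ j ∈ Finset.Icc 1 (nI ℓ), 0 < wgt ℓ j)
    (hwm : ∀ ℓ, ∀ j k : ℕ, 1 ≤ j → j ≤ k → k ≤ nI ℓ → wgt ℓ j ≤ wgt ℓ k)
    (N : ι → ℕ) (hN : ∀ ℓ, N ℓ ≤ nI ℓ) :
    IK.wtot wgt (IK.trunc ε wgt nI e N) ≤ IK.wtot wgt N := by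
  by_cases hne : (IK.heavy e N).Nonempty
  · have hW := IK.WH_pos hw0 hN hne
    have hb : 0 < IK.base ε wgt e N := by
      have hn : (0 : ℝ) < Fintype.card ι := by exact_mod_cast Fintype.card_pos
      exact IK.P2_pos (by positivity)
    have hheavy : ∑ ℓ ∈ IK.heavy e N, IK.Wcl wgt ℓ (e + 1) (IK.trunc ε wgt nI e N ℓ) ≤
        IK.WH wgt e N := by
      calc ∑ ℓ ∈ IK.heavy e N, IK.Wcl wgt ℓ (e + 1) (IK.trunc ε wgt nI e N ℓ)
          ≤ ∑ ℓ ∈ IK.heavy e N,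
              (1 - 2 * ε) * (IK.Wcl wgt ℓ (e + 1) (N ℓ) + IK.base ε wgt e N) :=
            Finset.sum_le_sum fun ℓ hℓ =>
              (IK.trunc_heavy hε0 hε (hw0 ℓ) (hwm ℓ) hb (Finset.mem_filter.1 hℓ).2
                (hN ℓ)).2.trans
                (mul_le_mul_of_nonneg_left (IK.Ecl_le_add_base hb) (by linarith))
        _ = (1 - 2 * ε) * (IK.WH wgt e N + (IK.heavy e N).card * IK.base ε wgt e N) := by
            rw [← Finset.mul_sum, Finset.sum_add_distrib, Finset.sum_const, nsmul_eq_mul, IK.WH]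
        _ ≤ (1 - 2 * ε) * (IK.WH wgt e N + 2 * ε * IK.WH wgt e N) :=
            mul_le_mul_of_nonneg_left
              (by linarith [IK.card_heavy_mul_base_le hε0 hW]) (by linarith)
        _ ≤ IK.WH wgt e N := by nlinarith [mul_nonneg (sq_nonneg ε) hW.le]
    have hdiff : IK.wtot wgt (IK.trunc ε wgt nI e N) - IK.wtot wgt N =
        ∑ ℓ ∈ IK.heavy e N, (IK.Wcl wgt ℓ (e + 1) (IK.trunc ε wgt nI e N ℓ) -
          IK.Wcl wgt ℓ (e + 1) (N ℓ)) := by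
      rw [IK.wtot, IK.wtot, ← Finset.sum_sub_distrib, IK.heavy, Finset.sum_filter]
      refine Finset.sum_congr rfl fun ℓ _ => ?_
      split_ifs with hℓ
      · rw [IK.Wcl_split wgt ℓ hℓ.le, IK.Wcl_split wgt ℓ
          (IK.trunc_heavy hε0 hε (hw0 ℓ) (hwm ℓ) hb hℓ (hN ℓ)).1]
        ring
      · rw [IK.trunc_light hℓ, sub_self]
    rw [Finset.sum_sub_distrib, ← IK.WH] at hdiff
    linarith
  · have htrunc : IK.trunc ε wgt nI e N = N := funext fun ℓ =>
      IK.trunc_light fun hℓ => hne ⟨ℓ, Finset.mem_filter.2 ⟨Finset.mem_univ ℓ, hℓ⟩⟩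
    rw [htrunc]
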